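/- arXiv:1911.12825 — 2 statements merged into one kernel-verified Lean document; each statement's English description precedes it below -/
import Mathlib

section
/- The joint-option Bellman operator T, defined on functions Q : S × Ω → ℝ by (TQ)(s,ω) := ∑_{a∈A} π(ω,s,a) · ( r(s,a) + γ · ∑_{s'∈S} p(a,s,s') · U_Q(ω,s') ), has exactly one fixed point: there exists a unique Q : S × Ω → ℝ with TQ = Q. -/
open Finset

/-- Option-value upon arrival: `U_Q(ω,s) = β(ω,s)·Q(s,ω) + (1−β(ω,s))·max_{ω'} Q(s,ω')`. -/
noncomputable def Uval {S Ω : Type*} [Fintype Ω] [Nonempty Ω]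
    (β : Ω → S → ℝ) (Q : S × Ω → ℝ) (ω : Ω) (s : S) : ℝ :=
  β ω s * Q (s, ω) + (1 - β ω s) * (univ.sup' univ_nonempty fun ω' => Q (s, ω'))

theorem Uval_le_add {S Ω : Type*} [Fintype Ω] [Nonempty Ω]
    (β : Ω → S → ℝ) (hβ0 : ∀ ω s, 0 ≤ β ω s) (hβ1 : ∀ ω s, β ω s ≤ 1)
    (Q R : S × Ω → ℝ) (d : ℝ) (h : ∀ x, Q x ≤ R x + d) (ω : Ω) (s : S) :
    Uval β Q ω s ≤ Uval β R ω s + d := by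
  unfold Uval
  have h1 : (univ.sup' univ_nonempty fun ω' => Q (s, ω'))
      ≤ (univ.sup' univ_nonempty fun ω' => R (s, ω')) + d := by
    apply Finset.sup'_le
    intro b _
    have := Finset.le_sup' (fun ω' => R (s, ω')) (mem_univ b)
    have := h (s, b)
    linarith
  have h2 := mul_le_mul_of_nonneg_left (h (s, ω)) (hβ0 ω s)
  have h3 := mul_le_mul_of_nonneg_left h1 (sub_nonneg.2 (hβ1 ω s))
  linarith

theorem avg_le_add {ι : Type*} [Fintype ι] (w f g : ι → ℝ) (d : ℝ)
    (h0 : ∀ i, 0 ≤ w i) (h1 : ∑ i, w i = 1) (h : ∀ i, f i ≤ g i + d) :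
    ∑ i, w i * f i ≤ ∑ i, w i * g i + d := by
  calc ∑ i, w i * f i ≤ ∑ i, w i * (g i + d) :=
        Finset.sum_le_sum fun i _ => mul_le_mul_of_nonneg_left (h i) (h0 i)
    _ = ∑ i, w i * g i + d := by
        simp only [mul_add, Finset.sum_add_distrib, ← Finset.sum_mul, h1, one_mul]

/-- The joint-option Bellman operator
`(TQ)(s,ω) = ∑_a π(ω,s,a)·(r(s,a) + γ·∑_{s'} p(a,s,s')·U_Q(ω,s'))`
has exactly one fixed point. -/
theorem bellman_operator_unique_fixed_point
    {S Ω A : Type*} [Fintype S] [Nonempty S] [Fintype Ω] [Nonempty Ω]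
    [Fintype A] [Nonempty A]
    (γ : ℝ) (hγ0 : 0 < γ) (hγ1 : γ < 1)
    (π : Ω → S → A → ℝ) (hπ0 : ∀ ω s a, 0 ≤ π ω s a)
    (hπ1 : ∀ ω s, ∑ a, π ω s a = 1)
    (p : A → S → S → ℝ) (hp0 : ∀ a s s', 0 ≤ p a s s')
    (hp1 : ∀ a s, ∑ s', p a s s' = 1)
    (β : Ω → S → ℝ) (hβ0 : ∀ ω s, 0 ≤ β ω s) (hβ1 : ∀ ω s, β ω s ≤ 1)
    (r : S → A → ℝ) :
    ∃! Q : S × Ω → ℝ, ∀ (s : S) (ω : Ω),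
      (∑ a, π ω s a * (r s a + γ * ∑ s', p a s s' * Uval β Q ω s')) = Q (s, ω) := by
  let T : (S × Ω → ℝ) → (S × Ω → ℝ) := fun Q x =>
    ∑ a, π x.2 x.1 a * (r x.1 a + γ * ∑ s', p a x.1 s' * Uval β Q x.2 s')
  have key : ∀ (Q R : S × Ω → ℝ) (d : ℝ), (∀ x, Q x ≤ R x + d) →
      ∀ x, T Q x ≤ T R x + γ * d := by
    intro Q R d h x
    refine avg_le_add _ _ _ _ (hπ0 _ _) (hπ1 _ _) fun a => ?_
    have h1 := avg_le_add (p a x.1) _ _ d (hp0 _ _) (hp1 _ _)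
      (Uval_le_add β hβ0 hβ1 Q R d h x.2)
    have h2 := mul_le_mul_of_nonneg_left h1 hγ0.le
    linarith
  have hc : ContractingWith ⟨γ, hγ0.le⟩ T := by
    refine ⟨by exact_mod_cast hγ1, LipschitzWith.of_dist_le_mul fun Q R => ?_⟩
    have hd : ∀ x, |Q x - R x| ≤ dist Q R := fun x => dist_le_pi_dist Q R x
    refine (dist_pi_le_iff (by positivity)).2 fun x => ?_
    have h1 := key Q R (dist Q R) (fun x => by linarith [(abs_le.1 (hd x)).2]) x
    have h2 := key R Q (dist Q R) (fun x => by linarith [(abs_le.1 (hd x)).1]) x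
    rw [Real.dist_eq, abs_le]
    change -(γ * dist Q R) ≤ _ ∧ _ ≤ γ * dist Q R
    constructor <;> linarith
  refine ⟨hc.fixedPoint T, fun s ω => congrFun hc.fixedPoint_isFixedPt (s, ω), ?_⟩
  intro Q hQ
  exact hc.fixedPoint_unique (funext fun x => hQ x.1 x.2)
end

section
/- (Finite-space version of Lemma 5.1, part 3: expected reward is determined by the common belief.) For every function f : S → ℝ and every y ∈ 𝒴 with P(Y = y) := ∑_{ω : Y(ω)=y} P(ω) > 0, the conditional expectation of f(X) given the belief B equals the belief-average of f: ( ∑_{ω : B(ω)=b_y} P(ω)·f(X(ω)) ) / ( ∑_{ω : B(ω)=b_y} P(ω) ) = ∑_{s∈S} f(s)·b_y(s). -/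
open Finset
open scoped Classical

/-- Common-information-based belief:
`b_y(s) = P(X = s, Y = y) / P(Y = y)` when `P(Y = y) > 0`, and `0` otherwise. -/
noncomputable def ciBelief {Ω₀ S 𝒴 : Type*} [Fintype Ω₀]
    (P : Ω₀ → ℝ) (X : Ω₀ → S) (Y : Ω₀ → 𝒴) (y : 𝒴) (s : S) : ℝ :=
  if 0 < ∑ ω ∈ univ.filter (fun ω => Y ω = y), P ω then
    (∑ ω ∈ univ.filter (fun ω => X ω = s ∧ Y ω = y), P ω) /
      (∑ ω ∈ univ.filter (fun ω => Y ω = y), P ω)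
  else 0

theorem ciBelief_mass {Ω₀ S 𝒴 : Type*} [Fintype Ω₀]
    (P : Ω₀ → ℝ) (hP0 : ∀ ω, 0 ≤ P ω) (X : Ω₀ → S) (Y : Ω₀ → 𝒴) (z : 𝒴) (s : S) :
    (∑ ω ∈ univ.filter (fun ω => Y ω = z), P ω) * ciBelief P X Y z s
      = ∑ ω ∈ univ.filter (fun ω => X ω = s ∧ Y ω = z), P ω := by
  unfold ciBelief
  split_ifs with h
  · field_simp
  · have h0 : ∑ ω ∈ univ.filter (fun ω => Y ω = z), P ω = 0 :=
      le_antisymm (not_lt.mp h) (sum_nonneg fun ω _ => hP0 ω)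
    rw [mul_zero]
    rw [sum_eq_zero_iff_of_nonneg (fun ω _ => hP0 ω)] at h0
    symm
    apply sum_eq_zero
    intro ω hω
    apply h0
    simp only [mem_filter, mem_univ, true_and] at hω ⊢
    exact hω.2

theorem ciBelief_fiber {Ω₀ S 𝒴 : Type*} [Fintype Ω₀] [Fintype S]
    (P : Ω₀ → ℝ) (hP0 : ∀ ω, 0 ≤ P ω) (X : Ω₀ → S) (Y : Ω₀ → 𝒴) (f : S → ℝ) (z : 𝒴) :
    ∑ ω ∈ univ.filter (fun ω => Y ω = z), P ω * f (X ω)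
      = (∑ ω ∈ univ.filter (fun ω => Y ω = z), P ω) * ∑ s, f s * ciBelief P X Y z s := by
  rw [mul_sum, ← sum_fiberwise _ X]
  refine sum_congr rfl fun s _ => ?_
  rw [mul_left_comm, ciBelief_mass P hP0, mul_sum, filter_filter]
  refine sum_congr (by ext ω; simp [and_comm]) fun ω hω => ?_
  simp only [mem_filter, mem_univ, true_and] at hω
  rw [hω.1, mul_comm]

/-- Finite-space version of Lemma 5.1, part 3: the expected reward is determined
by the common belief: `E[f(X) | B = b_y] = ∑_s f(s)·b_y(s)`, where `B(ω) = b_{Y(ω)}`. -/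
theorem common_belief_expected_reward
    {Ω₀ S 𝒴 : Type*} [Fintype Ω₀] [Nonempty Ω₀] [Fintype S] [Nonempty S]
    [Fintype 𝒴] [Nonempty 𝒴]
    (P : Ω₀ → ℝ) (hP0 : ∀ ω, 0 ≤ P ω) (hP1 : ∑ ω, P ω = 1)
    (X : Ω₀ → S) (Y : Ω₀ → 𝒴)
    (f : S → ℝ)
    (y : 𝒴) (hy : 0 < ∑ ω ∈ univ.filter (fun ω => Y ω = y), P ω) :
    (∑ ω ∈ univ.filter (fun ω => ciBelief P X Y (Y ω) = ciBelief P X Y y), P ω * f (X ω)) /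
      (∑ ω ∈ univ.filter (fun ω => ciBelief P X Y (Y ω) = ciBelief P X Y y), P ω)
      = ∑ s, f s * ciBelief P X Y y s := by
  have hpos : 0 < ∑ ω ∈ univ.filter
      (fun ω => ciBelief P X Y (Y ω) = ciBelief P X Y y), P ω := by
    refine lt_of_lt_of_le hy (sum_le_sum_of_subset_of_nonneg ?_ fun ω _ _ => hP0 ω)
    intro ω hω
    simp only [mem_filter, mem_univ, true_and] at hω ⊢
    rw [hω]
  rw [div_eq_iff hpos.ne', mul_comm, ← sum_fiberwise _ Y,
    ← sum_fiberwise _ Y (fun ω => P ω), sum_mul]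
  refine sum_congr rfl fun z _ => ?_
  rw [filter_filter]
  by_cases hz : ciBelief P X Y z = ciBelief P X Y y
  · have hs : univ.filter (fun ω => ciBelief P X Y (Y ω) = ciBelief P X Y y ∧ Y ω = z)
        = univ.filter (fun ω => Y ω = z) := by
      ext ω
      simp only [mem_filter, mem_univ, true_and, and_iff_right_iff_imp]
      rintro rfl
      exact hz
    rw [hs, ciBelief_fiber P hP0, hz]
  · have hs : univ.filter (fun ω => ciBelief P X Y (Y ω) = ciBelief P X Y y ∧ Y ω = z)
        = ∅ := by
      ext ω
      simp only [mem_filter, mem_univ, true_and, notMem_empty, iff_false, not_and]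
      rintro h rfl
      exact hz h
    rw [hs]
    simp
end
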